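/- arXiv:1901.00813 — 6 statements merged into one kernel-verified Lean document; each statement's English description precedes it below -/
import Mathlib

section
/- Let c, G > 0, let Q ∈ ℝ, Q ≠ 0, let m₀ ≤ 0 and M > m₀ be real numbers, and let ζ : (0,∞) → [0,∞) be measurable with 0 < I_ζ < ∞, where I_ζ := 2^{−11/4} ∫₀^∞ y^{−7/4} ζ(y) dy. Set λ := |Q|^{3/2} I_ζ / ((M − m₀)c²) and ζ_λ(μ) := λ⁻⁴ ζ(λ⁴μ). Then the cumulative mass function m(r) := m₀ + (1/c²) ∫₀^r ζ_λ(Q²/(2s⁴)) s² ds satisfies lim_{r→∞} m(r) = m₀ + |Q|^{3/2} I_{ζ_λ} / c² = M; that is, the λ-scaled electrostatic spacetime with charge Q has bare rest mass m₀ and ADM mass exactly M. -/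
open Filter Topology Set MeasureTheory

/-- The pointwise form of the change of variables `y = a * s ^ (-4)`. -/
lemma comp_div_pow_four_mul_sq {a s : ℝ} (ha : 0 < a) (hs : 0 < s) (f : ℝ → ℝ) :
    f (a / s ^ 4) * s ^ 2 = a ^ ((7:ℝ)/4) / 4 * ((|(-4:ℝ)| * s ^ ((-4:ℝ) - 1)) •
      ((a * s ^ (-4:ℝ)) ^ (-(7:ℝ)/4) * f (a * s ^ (-4:ℝ)))) := by
  have h4 : s ^ (-4:ℝ) = (s ^ 4)⁻¹ := by
    rw [Real.rpow_neg hs.le]; norm_cast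
  have hpow : s ^ ((-4:ℝ) - 1) * (s ^ (-4:ℝ)) ^ (-(7:ℝ)/4) = s ^ 2 := by
    rw [← Real.rpow_mul hs.le, ← Real.rpow_add hs, ← Real.rpow_natCast]
    norm_num
  have hone : a ^ ((7:ℝ)/4) * a ^ (-(7:ℝ)/4) = 1 := by
    rw [← Real.rpow_add ha]; norm_num
  rw [Real.mul_rpow ha.le (Real.rpow_nonneg hs.le _), div_eq_mul_inv, ← h4, smul_eq_mul,
    abs_neg, abs_of_pos (by norm_num : (0:ℝ) < 4)]
  linear_combination (-f (a * s ^ (-4:ℝ)) * s ^ 2) * hone -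
    f (a * s ^ (-4:ℝ)) * a ^ ((7:ℝ)/4) * a ^ (-(7:ℝ)/4) * hpow

lemma integrableOn_comp_div_pow_four_mul_sq {a : ℝ} (ha : 0 < a) {f : ℝ → ℝ}
    (hf : IntegrableOn (fun y => y ^ (-(7:ℝ)/4) * f y) (Ioi 0)) :
    IntegrableOn (fun s => f (a / s ^ 4) * s ^ 2) (Ioi 0) := by
  have hscaled : IntegrableOn (fun y => (a * y) ^ (-(7:ℝ)/4) * f (a * y)) (Ioi 0) :=
    (integrableOn_Ioi_comp_mul_left_iff (fun y => y ^ (-(7:ℝ)/4) * f y) 0 ha).2 (by simpa using hf)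
  have hsubst := (integrableOn_Ioi_comp_rpow_iff _ (by norm_num : (-4:ℝ) ≠ 0)).2 hscaled
  exact IntegrableOn.congr_fun (hsubst.const_mul (a ^ ((7:ℝ)/4) / 4))
    (fun s hs => (comp_div_pow_four_mul_sq ha hs f).symm) measurableSet_Ioi

lemma integral_comp_div_pow_four_mul_sq {a : ℝ} (ha : 0 < a) (f : ℝ → ℝ) :
    ∫ s in Ioi (0:ℝ), f (a / s ^ 4) * s ^ 2 =
      a ^ ((3:ℝ)/4) / 4 * ∫ y in Ioi (0:ℝ), y ^ (-(7:ℝ)/4) * f y := by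
  rw [setIntegral_congr_fun measurableSet_Ioi
      (fun s hs => comp_div_pow_four_mul_sq ha hs f), integral_const_mul,
    integral_comp_rpow_Ioi (fun y => (a * y) ^ (-(7:ℝ)/4) * f (a * y)) (by norm_num : (-4:ℝ) ≠ 0),
    integral_comp_mul_left_Ioi (fun y => y ^ (-(7:ℝ)/4) * f y) 0 ha, mul_zero, smul_eq_mul]
  have hpow : a ^ ((7:ℝ)/4) * a⁻¹ = a ^ ((3:ℝ)/4) := by
    rw [← Real.rpow_neg_one, ← Real.rpow_add ha]; norm_num
  rw [← hpow]
  ring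

/-- The pointwise form of the scaling `y ↦ l ^ 4 * y` of the weighted Hamiltonian. -/
lemma rpow_mul_scaled {l y : ℝ} (hl : 0 < l) (hy : 0 < y) (f : ℝ → ℝ) :
    y ^ (-(7:ℝ)/4) * (f (l ^ 4 * y) / l ^ 4) =
      l ^ 3 * ((l ^ 4 * y) ^ (-(7:ℝ)/4) * f (l ^ 4 * y)) := by
  have hpow : (l ^ 4) ^ (-(7:ℝ)/4) = (l ^ 7)⁻¹ := by
    rw [← Real.rpow_natCast, ← Real.rpow_mul hl.le, ← Real.rpow_natCast, ← Real.rpow_neg hl.le]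
    norm_num
  rw [Real.mul_rpow (by positivity) hy.le, hpow]
  field_simp

lemma integrableOn_rpow_mul_scaled {l : ℝ} (hl : 0 < l) {f : ℝ → ℝ}
    (hf : IntegrableOn (fun y => y ^ (-(7:ℝ)/4) * f y) (Ioi 0)) :
    IntegrableOn (fun y => y ^ (-(7:ℝ)/4) * (f (l ^ 4 * y) / l ^ 4)) (Ioi 0) := by
  have hscaled : IntegrableOn (fun y => (l ^ 4 * y) ^ (-(7:ℝ)/4) * f (l ^ 4 * y)) (Ioi 0) :=
    (integrableOn_Ioi_comp_mul_left_iff (fun y => y ^ (-(7:ℝ)/4) * f y) 0 (pow_pos hl 4)).2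
      (by simpa using hf)
  exact IntegrableOn.congr_fun (hscaled.const_mul (l ^ 3))
    (fun y hy => (rpow_mul_scaled hl hy f).symm) measurableSet_Ioi

lemma integral_rpow_mul_scaled {l : ℝ} (hl : 0 < l) (f : ℝ → ℝ) :
    ∫ y in Ioi (0:ℝ), y ^ (-(7:ℝ)/4) * (f (l ^ 4 * y) / l ^ 4) =
      l⁻¹ * ∫ y in Ioi (0:ℝ), y ^ (-(7:ℝ)/4) * f y := by
  rw [setIntegral_congr_fun measurableSet_Ioi (fun y hy => rpow_mul_scaled hl hy f),
    integral_const_mul,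
    integral_comp_mul_left_Ioi (fun y => y ^ (-(7:ℝ)/4) * f y) 0 (pow_pos hl 4), mul_zero,
    smul_eq_mul, ← mul_assoc]
  congr 1
  field_simp

lemma sq_half_rpow_div_four (Q : ℝ) :
    (Q ^ 2 / 2) ^ ((3:ℝ)/4) / 4 = |Q| ^ ((3:ℝ)/2) * (2:ℝ) ^ (-(11:ℝ)/4) := by
  have hQ : (Q ^ 2) ^ ((3:ℝ)/4) = |Q| ^ ((3:ℝ)/2) := by
    rw [← sq_abs, ← Real.rpow_natCast, ← Real.rpow_mul (abs_nonneg Q)]; norm_num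
  have htwo : (2:ℝ) ^ (-(11:ℝ)/4) * 2 ^ ((3:ℝ)/4) * 4 = 1 := by
    rw [← Real.rpow_add (by norm_num)]; norm_num [Real.rpow_neg]
  rw [Real.div_rpow (by positivity) (by norm_num), hQ, div_div, div_eq_iff (by positivity)]
  linear_combination -|Q| ^ ((3:ℝ)/2) * htwo

/-- Proposition 3.1, quantitative part: with
λ := |Q|^{3/2} I_ζ / ((M − m₀)c²) and the λ-scaled Hamiltonian
ζ_λ(μ) := λ⁻⁴ ζ(λ⁴μ), the cumulative mass function
m(r) := m₀ + (1/c²)∫₀^r ζ_λ(Q²/(2s⁴)) s² ds satisfies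
lim_{r→∞} m(r) = m₀ + |Q|^{3/2} I_{ζ_λ}/c² = M. -/
theorem weak_bianchi_stmt7 (c G : ℝ) (hc : 0 < c) (hG : 0 < G)
    (Q : ℝ) (hQ : Q ≠ 0) (m₀ M : ℝ) (hm₀ : m₀ ≤ 0) (hM : m₀ < M)
    (ζ : ℝ → ℝ) (hmeas : Measurable ζ) (hnn : ∀ y > (0:ℝ), 0 ≤ ζ y)
    (hint : IntegrableOn (fun y => y ^ (-(7:ℝ)/4) * ζ y) (Ioi 0))
    (Iζ : ℝ) (hIζ : Iζ = (2:ℝ) ^ (-(11:ℝ)/4) * ∫ y in Ioi (0:ℝ), y ^ (-(7:ℝ)/4) * ζ y)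
    (hIpos : 0 < Iζ)
    (l : ℝ) (hl : l = |Q| ^ ((3:ℝ)/2) * Iζ / ((M - m₀) * c^2))
    (ζl : ℝ → ℝ) (hζl : ∀ μ, ζl μ = ζ (l^4 * μ) / l^4)
    (Iζl : ℝ)
    (hIζl : Iζl = (2:ℝ) ^ (-(11:ℝ)/4) * ∫ y in Ioi (0:ℝ), y ^ (-(7:ℝ)/4) * ζl y)
    (m : ℝ → ℝ)
    (hm : ∀ r, m r = m₀ + (1/c^2) * ∫ s in Ioc (0:ℝ) r, ζl (Q^2 / (2 * s^4)) * s^2) :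
    Tendsto m atTop (𝓝 (m₀ + |Q| ^ ((3:ℝ)/2) * Iζl / c^2)) ∧
      m₀ + |Q| ^ ((3:ℝ)/2) * Iζl / c^2 = M := by
  have hMm : 0 < M - m₀ := sub_pos.2 hM
  have hQabs : 0 < |Q| ^ ((3:ℝ)/2) := Real.rpow_pos_of_pos (abs_pos.2 hQ) _
  have hlpos : 0 < l := by rw [hl]; positivity
  obtain rfl : ζl = fun μ => ζ (l ^ 4 * μ) / l ^ 4 := funext hζl
  have ha : 0 < Q ^ 2 / 2 := by positivity
  refine ⟨?_, ?_⟩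
  · have hsub := integrableOn_comp_div_pow_four_mul_sq ha (integrableOn_rpow_mul_scaled hlpos hint)
    have hval := integral_comp_div_pow_four_mul_sq ha (fun μ => ζ (l ^ 4 * μ) / l ^ 4)
    rw [sq_half_rpow_div_four, mul_assoc, ← hIζl] at hval
    have hlim := intervalIntegral_tendsto_integral_Ioi 0 hsub tendsto_id
    rw [hval] at hlim
    have hmlim := (hlim.const_mul (1 / c ^ 2)).const_add m₀
    rw [one_div_mul_eq_div] at hmlim
    refine hmlim.congr' ?_
    filter_upwards [eventually_ge_atTop 0] with r hr
    rw [hm, id, intervalIntegral.integral_of_le hr]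
    simp only [div_div]
  · have hscale : Iζl = l⁻¹ * Iζ := by
      rw [hIζl, integral_rpow_mul_scaled hlpos, hIζ]
      ring
    rw [hscale, hl]
    field_simp
    ring
end

section
/- Let G, c > 0 and let m : (0,∞) → ℝ be continuous with lim_{r→0⁺} m(r) = m₀ > 0 and lim_{r→∞} m(r) = m_∞ ∈ ℝ. Then there exists r₀ > 0 such that c² r₀ − 2G m(r₀) = 0; equivalently, the metric coefficient e^{2α(r)} := 1 − 2G m(r)/(c² r) vanishes at r = r₀ (a Killing horizon). -/
open Filter Topology Set

/-- Case 1 of Section 3.2: if the cumulative mass function m is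
continuous on (0,∞) with m(r) → m₀ > 0 as r → 0⁺ and m(r) → m_∞ ∈ ℝ as r → ∞,
then there is r₀ > 0 with c²r₀ − 2Gm(r₀) = 0, i.e. the metric coefficient
e^{2α(r)} = 1 − 2Gm(r)/(c²r) vanishes at r₀ (a Killing horizon). -/
theorem weak_bianchi_stmt8 (G c : ℝ) (hG : 0 < G) (hc : 0 < c)
    (m : ℝ → ℝ) (m₀ m_inf : ℝ)
    (hcont : ContinuousOn m (Ioi 0))
    (h0 : Tendsto m (𝓝[>] (0:ℝ)) (𝓝 m₀)) (hm₀ : 0 < m₀)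
    (hinf : Tendsto m atTop (𝓝 m_inf)) :
    ∃ r₀ > (0:ℝ), c^2 * r₀ - 2 * G * m r₀ = 0 ∧
      1 - 2 * G * m r₀ / (c^2 * r₀) = 0 := by
  have hzero : Tendsto (fun r => c^2 * r - 2 * G * m r) (𝓝[>] 0) (𝓝 (c^2 * 0 - 2 * G * m₀)) :=
    ((tendsto_id.mono_left nhdsWithin_le_nhds).const_mul _).sub (h0.const_mul _)
  have htop : Tendsto (fun r => c^2 * r - 2 * G * m r) atTop atTop := by
    simpa only [sub_eq_add_neg, id] using
      (tendsto_id.const_mul_atTop (pow_pos hc 2)).atTop_add (hinf.const_mul (2 * G)).neg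
  have hneg : c^2 * 0 - 2 * G * m₀ < 0 := by
    have := mul_pos hG hm₀
    linarith
  obtain ⟨r, hr, hroot⟩ := isPreconnected_Ioi.intermediate_value₂_eventually₂
    (l₁ := 𝓝[>] (0:ℝ)) (l₂ := atTop) (f := fun r => c^2 * r - 2 * G * m r) (g := fun _ => 0)
    inf_le_right (le_principal_iff.mpr (Ioi_mem_atTop 0))
    ((continuousOn_const.mul continuousOn_id).sub (continuousOn_const.mul hcont))
    continuousOn_const
    ((hzero.eventually_lt_const hneg).mono fun _ h => h.le)
    (htop.eventually_ge_atTop 0)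
  refine ⟨r, hr, hroot, ?_⟩
  have hpos : 0 < c^2 * r := mul_pos (pow_pos hc 2) hr
  rw [← sub_eq_zero.mp hroot, div_self hpos.ne', sub_self]
end

section
/- Let G, c, J > 0, Q ∈ ℝ with Q ≠ 0, m₀ ≤ 0, and let ζ : (0,∞) → ℝ be measurable with 0 ≤ ζ(μ) ≤ J√μ for all μ > 0. Define m(r) := m₀ + (1/c²)∫₀^r ζ(Q²/(2s⁴)) s² ds. If J|Q|G/c⁴ < 1/√2, then for every r > 0 the metric coefficient satisfies e^{2α(r)} = 1 − 2G m(r)/(c² r) ≥ 1 − √2 J|Q| G/c⁴ > 0; in particular the spacetime has no horizon. -/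
open Filter Topology Set MeasureTheory

/-- If `0 ≤ ζ μ ≤ J √μ` for positive `μ`, the field energy of a point charge `Q` inside radius `r`
is at most `J |Q| r / √2`. -/
theorem setIntegral_reduced_hamiltonian_le {J : ℝ} {Q : ℝ} (hQ : Q ≠ 0) {ζ : ℝ → ℝ}
    (hb : ∀ μ > (0:ℝ), 0 ≤ ζ μ ∧ ζ μ ≤ J * Real.sqrt μ) {r : ℝ} (hr : 0 ≤ r) :
    ∫ s in Ioc (0:ℝ) r, ζ (Q^2 / (2 * s^4)) * s^2 ≤ J * |Q| / Real.sqrt 2 * r := by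
  have hbound : ∀ s ∈ Ioc (0:ℝ) r,
      ‖ζ (Q^2 / (2 * s^4)) * s^2‖ ≤ J * |Q| / Real.sqrt 2 := by
    rintro s ⟨hs, -⟩
    obtain ⟨h0, h1⟩ := hb (Q^2 / (2 * s^4)) (by positivity)
    have hsqrt : Real.sqrt (Q^2 / (2 * s^4)) = |Q| / (Real.sqrt 2 * s^2) := by
      rw [Real.sqrt_div (sq_nonneg Q), Real.sqrt_sq_eq_abs, Real.sqrt_mul zero_le_two,
        show s^4 = (s^2)^2 by ring, Real.sqrt_sq (sq_nonneg s)]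
    rw [Real.norm_of_nonneg (by positivity)]
    calc ζ (Q^2 / (2 * s^4)) * s^2 ≤ J * (|Q| / (Real.sqrt 2 * s^2)) * s^2 := by
          rw [← hsqrt]; gcongr
      _ = J * |Q| / Real.sqrt 2 := by field_simp
  have h := norm_setIntegral_le_of_norm_le_const (μ := volume) measure_Ioc_lt_top hbound
  rw [Real.volume_real_Ioc_of_le hr, sub_zero] at h
  exact (Real.le_norm_self _).trans h

/-- naked-singularity criterion (nakedq0): with m₀ ≤ 0,
0 ≤ ζ(μ) ≤ J√μ, and J|Q|G/c⁴ < 1/√2, the metric coefficient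
e^{2α(r)} = 1 − 2Gm(r)/(c²r) satisfies
e^{2α(r)} ≥ 1 − √2 J|Q|G/c⁴ > 0 for all r > 0, so there is no horizon. -/
theorem weak_bianchi_stmt11 (G c J : ℝ) (hG : 0 < G) (hc : 0 < c) (hJ : 0 < J)
    (Q : ℝ) (hQ : Q ≠ 0) (m₀ : ℝ) (hm₀ : m₀ ≤ 0)
    (ζ : ℝ → ℝ) (hmeas : Measurable ζ)
    (hb : ∀ μ > (0:ℝ), 0 ≤ ζ μ ∧ ζ μ ≤ J * Real.sqrt μ)
    (m : ℝ → ℝ)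
    (hm : ∀ r, m r = m₀ + (1/c^2) * ∫ s in Ioc (0:ℝ) r, ζ (Q^2 / (2 * s^4)) * s^2)
    (hsmall : J * |Q| * G / c^4 < 1 / Real.sqrt 2) :
    ∀ r > (0:ℝ),
      (1 - Real.sqrt 2 * J * |Q| * G / c^4 ≤ 1 - 2 * G * m r / (c^2 * r)) ∧
      0 < 1 - Real.sqrt 2 * J * |Q| * G / c^4 := by
  intro r hr
  have h2 : Real.sqrt 2 * Real.sqrt 2 = 2 := Real.mul_self_sqrt zero_le_two
  have hs2 : 0 < Real.sqrt 2 := by positivity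
  constructor
  · have hmr : m r ≤ (1/c^2) * (J * |Q| / Real.sqrt 2 * r) := by
      rw [hm r]
      have := mul_le_mul_of_nonneg_left (setIntegral_reduced_hamiltonian_le hQ hb hr.le)
        (show 0 ≤ 1/c^2 by positivity)
      linarith
    have hle : 2 * G * m r / (c^2 * r) ≤ Real.sqrt 2 * J * |Q| * G / c^4 := by
      calc 2 * G * m r / (c^2 * r)
          ≤ 2 * G * ((1/c^2) * (J * |Q| / Real.sqrt 2 * r)) / (c^2 * r) := by gcongr
        _ = (Real.sqrt 2 * Real.sqrt 2) * G * ((1/c^2) * (J * |Q| / Real.sqrt 2 * r))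
              / (c^2 * r) := by rw [h2]
        _ = Real.sqrt 2 * J * |Q| * G / c^4 := by field_simp
    linarith
  · rw [lt_div_iff₀ hs2] at hsmall
    have : Real.sqrt 2 * J * |Q| * G / c^4 = J * |Q| * G / c^4 * Real.sqrt 2 := by ring
    linarith
end

section
/- Let G, c > 0, Q ∈ ℝ with Q ≠ 0, m₀ ≤ 0 and M > m₀. Let ζ : (0,∞) → ℝ be measurable with 0 ≤ ζ(μ) ≤ J√μ for all μ > 0 (for some J > 0) and with 0 < I_ζ < ∞, where I_ζ := 2^{−11/4} ∫₀^∞ y^{−7/4} ζ(y) dy. Set λ := |Q|^{3/2} I_ζ/((M − m₀)c²), ζ_λ(μ) := λ⁻⁴ζ(λ⁴μ), and m_λ(r) := m₀ + (1/c²)∫₀^r ζ_λ(Q²/(2s⁴)) s² ds. If G(M − m₀)²/Q² < I_ζ²/(√2 J), then 1 − 2G m_λ(r)/(c² r) > 0 for all r > 0; i.e., the λ-scaled electrostatic spacetime has a naked singularity at the center. -/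
open Filter Topology Set MeasureTheory

/-- The scaled energy density of a point charge is bounded by a constant times `s ^ (-2)`. -/
lemma scaled_density_bound {J Q l s : ℝ} {ζ ζl : ℝ → ℝ} (hl : 0 < l) (hQ : Q ≠ 0) (hs : 0 < s)
    (hb : ∀ μ > (0 : ℝ), 0 ≤ ζ μ ∧ ζ μ ≤ J * √μ) (hζl : ∀ μ, ζl μ = ζ (l ^ 4 * μ) / l ^ 4) :
    ‖ζl (Q ^ 2 / (2 * s ^ 4)) * s ^ 2‖ ≤ J * |Q| / (√2 * l ^ 2) := by
  obtain ⟨h0, h1⟩ := hb (l ^ 4 * (Q ^ 2 / (2 * s ^ 4))) (by positivity)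
  have hsqrt : √(l ^ 4 * (Q ^ 2 / (2 * s ^ 4))) = l ^ 2 * |Q| / (√2 * s ^ 2) := by
    rw [Real.sqrt_eq_iff_mul_self_eq (by positivity) (by positivity), ← sq, div_pow, mul_pow,
      mul_pow, sq_abs, Real.sq_sqrt (by norm_num)]
    field_simp
  rw [hsqrt] at h1
  rw [hζl, Real.norm_of_nonneg (by positivity)]
  calc ζ (l ^ 4 * (Q ^ 2 / (2 * s ^ 4))) / l ^ 4 * s ^ 2
      ≤ J * (l ^ 2 * |Q| / (√2 * s ^ 2)) / l ^ 4 * s ^ 2 := by gcongr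
    _ = J * |Q| / (√2 * l ^ 2) := by field_simp

/-- Proposition 3.2, prop:beta2: if the dimensionless ratio
G(M − m₀)²/Q² is smaller than I_ζ²/(√2 J), then the λ-scaled electrostatic
spacetime with charge Q, bare rest mass m₀ ≤ 0 and ADM mass M has
1 − 2Gm_λ(r)/(c²r) > 0 for all r > 0, i.e. a naked singularity at the center. -/
theorem weak_bianchi_stmt12 (G c J : ℝ) (hG : 0 < G) (hc : 0 < c) (hJ : 0 < J)
    (Q : ℝ) (hQ : Q ≠ 0) (m₀ M : ℝ) (hm₀ : m₀ ≤ 0) (hM : m₀ < M)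
    (ζ : ℝ → ℝ) (hmeas : Measurable ζ)
    (hb : ∀ μ > (0:ℝ), 0 ≤ ζ μ ∧ ζ μ ≤ J * Real.sqrt μ)
    (hint : IntegrableOn (fun y => y ^ (-(7:ℝ)/4) * ζ y) (Ioi 0))
    (Iζ : ℝ) (hIζ : Iζ = (2:ℝ) ^ (-(11:ℝ)/4) * ∫ y in Ioi (0:ℝ), y ^ (-(7:ℝ)/4) * ζ y)
    (hIpos : 0 < Iζ)
    (l : ℝ) (hl : l = |Q| ^ ((3:ℝ)/2) * Iζ / ((M - m₀) * c^2))
    (ζl : ℝ → ℝ) (hζl : ∀ μ, ζl μ = ζ (l^4 * μ) / l^4)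
    (ml : ℝ → ℝ)
    (hml : ∀ r, ml r = m₀ + (1/c^2) * ∫ s in Ioc (0:ℝ) r, ζl (Q^2 / (2 * s^4)) * s^2)
    (hcrit : G * (M - m₀)^2 / Q^2 < Iζ^2 / (Real.sqrt 2 * J)) :
    ∀ r > (0:ℝ), 0 < 1 - 2 * G * ml r / (c^2 * r) := by
  intro r hr
  have hlpos : 0 < l := by
    rw [hl]
    have := sub_pos.2 hM
    positivity
  have hlsq : l ^ 2 = |Q| ^ 3 * Iζ ^ 2 / ((M - m₀) ^ 2 * c ^ 4) := by
    have hQ3 : (|Q| ^ ((3 : ℝ) / 2)) ^ 2 = |Q| ^ 3 := by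
      rw [← Real.rpow_natCast, ← Real.rpow_mul (abs_nonneg Q), ← Real.rpow_natCast]
      norm_num
    rw [hl, div_pow, mul_pow, mul_pow, hQ3]
    ring
  have hI : ∫ s in Ioc (0 : ℝ) r, ζl (Q ^ 2 / (2 * s ^ 4)) * s ^ 2
      ≤ J * |Q| / (√2 * l ^ 2) * r := by
    simpa [hr.le] using (le_abs_self _).trans <|
      norm_setIntegral_le_of_norm_le_const (μ := volume) (s := Ioc (0 : ℝ) r) (by simp)
        fun s hs => scaled_density_bound hlpos hQ hs.1 hb hζl
  have h2 : (0 : ℝ) < √2 := by positivity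
  have hsq2 : √2 ^ 2 = (2 : ℝ) := Real.sq_sqrt (by norm_num)
  have hQpos : 0 < |Q| := abs_pos.2 hQ
  have hm : ml r ≤ 1 / c ^ 2 * (J * |Q| / (√2 * l ^ 2) * r) := by
    rw [hml]
    have := mul_le_mul_of_nonneg_left hI (show 0 ≤ 1 / c ^ 2 by positivity)
    linarith
  have hMpos := sub_pos.2 hM
  rw [sub_pos]
  calc 2 * G * ml r / (c ^ 2 * r)
      ≤ 2 * G * (1 / c ^ 2 * (J * |Q| / (√2 * l ^ 2) * r)) / (c ^ 2 * r) := by gcongr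
    _ = G * (M - m₀) ^ 2 / Q ^ 2 / (Iζ ^ 2 / (√2 * J)) := by
      rw [hlsq, ← sq_abs Q]
      field_simp
      rw [hsq2]
    _ < 1 := (div_lt_one (by positivity)).2 hcrit
end

section
/- Let Q ∈ ℝ with Q ≠ 0, and let ζ : (0,∞) → ℝ be differentiable with constants J, K, L > 0 such that J√μ − K ≤ ζ(μ) ≤ J√μ and J√μ − 2L ≤ 2μζ'(μ) ≤ J√μ for all μ > 0. Then the function g(r) := ζ(Q²/(2r⁴)) r² is differentiable on (0,∞) with g'(r) = 2r ζ(Q²/(2r⁴)) − 2 ζ'(Q²/(2r⁴)) Q²/r³, and for every r > 0: −2K r ≤ g'(r) ≤ 4L r. In particular, the cumulative mass function m(r) = m₀ + (1/c²)∫₀^r ζ(Q²/(2s⁴)) s² ds is twice differentiable on (0,∞) with −2Kr/c² ≤ m''(r) ≤ 4Lr/c², hence m''(r) → 0 as r ↓ 0. -/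
open Filter Topology Set MeasureTheory

/-- Fundamental theorem of calculus for an integrand that is continuous on `(0, ∞)` and bounded
on every `(0, b]`. -/
theorem hasDerivAt_integral_Ioc_zero_of_bounded {f : ℝ → ℝ} (hf : ContinuousOn f (Ioi 0))
    (hbound : ∀ b > (0 : ℝ), ∃ C, ∀ x ∈ Ioc (0 : ℝ) b, ‖f x‖ ≤ C) {r : ℝ} (hr : 0 < r) :
    HasDerivAt (fun x => ∫ s in Ioc (0 : ℝ) x, f s) (f r) r := by
  obtain ⟨C, hC⟩ := hbound r hr
  have hint : IntervalIntegrable f volume 0 r := by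
    rw [intervalIntegrable_iff_integrableOn_Ioc_of_le hr.le]
    exact IntegrableOn.of_bound (by simp)
      ((hf.mono Ioc_subset_Ioi_self).aestronglyMeasurable measurableSet_Ioc) C
      ((ae_restrict_iff' measurableSet_Ioc).2 (Eventually.of_forall hC))
  have hcont : ContinuousAt f r := hf.continuousAt (Ioi_mem_nhds hr)
  refine (intervalIntegral.integral_hasDerivAt_right hint
    (hf.stronglyMeasurableAtFilter isOpen_Ioi r hr) hcont).congr_of_eventuallyEq ?_
  filter_upwards [Ioi_mem_nhds hr] with x hx
  rw [intervalIntegral.integral_of_le (le_of_lt hx)]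

theorem sqrt_sq_div_two_mul_pow_four_mul_sq (Q : ℝ) {r : ℝ} (hr : 0 < r) :
    √(Q ^ 2 / (2 * r ^ 4)) * r ^ 2 = √(Q ^ 2 / 2) := by
  rw [show Q ^ 2 / (2 * r ^ 4) = Q ^ 2 / 2 / (r ^ 2) ^ 2 by field_simp,
    Real.sqrt_div (by positivity), Real.sqrt_sq (by positivity)]
  field_simp

theorem hasDerivAt_comp_sq_div_mul_sq {Q : ℝ} {ζ : ℝ → ℝ} {z r : ℝ} (hr : 0 < r)
    (hd : HasDerivAt ζ z (Q ^ 2 / (2 * r ^ 4))) :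
    HasDerivAt (fun x => ζ (Q ^ 2 / (2 * x ^ 4)) * x ^ 2)
      (2 * r * ζ (Q ^ 2 / (2 * r ^ 4)) - 2 * z * Q ^ 2 / r ^ 3) r := by
  have hinner : HasDerivAt (fun x : ℝ => Q ^ 2 / (2 * x ^ 4)) (-2 * Q ^ 2 / r ^ 5) r := by
    refine ((hasDerivAt_const r (Q ^ 2)).fun_div ((hasDerivAt_pow 4 r).const_mul 2)
      (by positivity)).congr_deriv ?_
    field_simp
    norm_num
    ring
  refine ((HasDerivAt.comp r hd hinner).fun_mul (hasDerivAt_pow 2 r)).congr_deriv ?_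
  simp only [Function.comp_apply]
  generalize ζ (Q ^ 2 / (2 * r ^ 4)) = a
  field_simp
  norm_num
  ring

/-- estimate (mest2): for differentiable ζ satisfying (R5), the
function g(r) := ζ(Q²/(2r⁴)) r² is differentiable on (0,∞) with
g'(r) = 2rζ(Q²/(2r⁴)) − 2ζ'(Q²/(2r⁴))Q²/r³ and −2Kr ≤ g'(r) ≤ 4Lr; in particular
the cumulative mass function m is twice differentiable on (0,∞) with
−2Kr/c² ≤ m''(r) ≤ 4Lr/c², hence m''(r) → 0 as r → 0⁺. -/
theorem weak_bianchi_stmt15 (c : ℝ) (hc : 0 < c) (Q : ℝ) (hQ : Q ≠ 0)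
    (m₀ J K L : ℝ) (hJ : 0 < J) (hK : 0 < K) (hL : 0 < L)
    (ζ ζ' : ℝ → ℝ) (hd : ∀ μ > (0:ℝ), HasDerivAt ζ (ζ' μ) μ)
    (hb1 : ∀ μ > (0:ℝ), J * Real.sqrt μ - K ≤ ζ μ ∧ ζ μ ≤ J * Real.sqrt μ)
    (hb2 : ∀ μ > (0:ℝ), J * Real.sqrt μ - 2 * L ≤ 2 * μ * ζ' μ ∧
      2 * μ * ζ' μ ≤ J * Real.sqrt μ)
    (g : ℝ → ℝ) (hg : ∀ r, g r = ζ (Q^2 / (2 * r^4)) * r^2)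
    (m : ℝ → ℝ)
    (hm : ∀ r, m r = m₀ + (1/c^2) * ∫ s in Ioc (0:ℝ) r, ζ (Q^2 / (2 * s^4)) * s^2) :
    (∀ r > (0:ℝ),
      HasDerivAt g (2 * r * ζ (Q^2 / (2 * r^4)) - 2 * ζ' (Q^2 / (2 * r^4)) * Q^2 / r^3) r ∧
      -(2 * K * r) ≤ 2 * r * ζ (Q^2 / (2 * r^4)) - 2 * ζ' (Q^2 / (2 * r^4)) * Q^2 / r^3 ∧
      2 * r * ζ (Q^2 / (2 * r^4)) - 2 * ζ' (Q^2 / (2 * r^4)) * Q^2 / r^3 ≤ 4 * L * r) ∧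
    (∀ r > (0:ℝ),
      HasDerivAt m (g r / c^2) r ∧
      HasDerivAt (fun x => g x / c^2)
        ((2 * r * ζ (Q^2 / (2 * r^4)) - 2 * ζ' (Q^2 / (2 * r^4)) * Q^2 / r^3) / c^2) r ∧
      -(2 * K * r / c^2)
        ≤ (2 * r * ζ (Q^2 / (2 * r^4)) - 2 * ζ' (Q^2 / (2 * r^4)) * Q^2 / r^3) / c^2 ∧
      (2 * r * ζ (Q^2 / (2 * r^4)) - 2 * ζ' (Q^2 / (2 * r^4)) * Q^2 / r^3) / c^2
        ≤ 4 * L * r / c^2) ∧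
    Tendsto (fun r => (2 * r * ζ (Q^2 / (2 * r^4)) - 2 * ζ' (Q^2 / (2 * r^4)) * Q^2 / r^3) / c^2)
      (𝓝[>] (0:ℝ)) (𝓝 0) := by
  have hμ : ∀ r > (0 : ℝ), 0 < Q ^ 2 / (2 * r ^ 4) := fun r hr => by positivity
  have hg_eq : g = fun r => ζ (Q ^ 2 / (2 * r ^ 4)) * r ^ 2 := funext hg
  have hderiv : ∀ r > (0 : ℝ), HasDerivAt g
      (2 * r * ζ (Q ^ 2 / (2 * r ^ 4)) - 2 * ζ' (Q ^ 2 / (2 * r ^ 4)) * Q ^ 2 / r ^ 3) r := by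
    intro r hr
    rw [hg_eq]
    exact hasDerivAt_comp_sq_div_mul_sq hr (hd _ (hμ r hr))
  have hfactor : ∀ r > (0 : ℝ),
      2 * r * ζ (Q ^ 2 / (2 * r ^ 4)) - 2 * ζ' (Q ^ 2 / (2 * r ^ 4)) * Q ^ 2 / r ^ 3 =
        2 * r * (ζ (Q ^ 2 / (2 * r ^ 4)) -
          2 * (Q ^ 2 / (2 * r ^ 4)) * ζ' (Q ^ 2 / (2 * r ^ 4))) := by
    intro r hr
    generalize ζ (Q ^ 2 / (2 * r ^ 4)) = a
    generalize ζ' (Q ^ 2 / (2 * r ^ 4)) = b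
    field_simp
  have hlower : ∀ r > (0 : ℝ), -(2 * K * r) ≤
      2 * r * ζ (Q ^ 2 / (2 * r ^ 4)) - 2 * ζ' (Q ^ 2 / (2 * r ^ 4)) * Q ^ 2 / r ^ 3 := by
    intro r hr
    rw [hfactor r hr]
    have h1 := (hb1 _ (hμ r hr)).1
    have h2 := (hb2 _ (hμ r hr)).2
    nlinarith
  have hupper : ∀ r > (0 : ℝ),
      2 * r * ζ (Q ^ 2 / (2 * r ^ 4)) - 2 * ζ' (Q ^ 2 / (2 * r ^ 4)) * Q ^ 2 / r ^ 3 ≤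
        4 * L * r := by
    intro r hr
    rw [hfactor r hr]
    have h1 := (hb1 _ (hμ r hr)).2
    have h2 := (hb2 _ (hμ r hr)).1
    nlinarith
  have hbound : ∀ b > (0 : ℝ), ∃ C, ∀ x ∈ Ioc (0 : ℝ) b, ‖g x‖ ≤ C := by
    intro b hb
    refine ⟨J * √(Q ^ 2 / 2) + K * b ^ 2, fun x ⟨hx, hxb⟩ => ?_⟩
    obtain ⟨h1, h2⟩ := hb1 _ (hμ x hx)
    have hx2 : x ^ 2 ≤ b ^ 2 := by gcongr
    have h3 := mul_le_mul_of_nonneg_right h1 (sq_nonneg x)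
    have h4 := mul_le_mul_of_nonneg_right h2 (sq_nonneg x)
    rw [sub_mul, mul_assoc, sqrt_sq_div_two_mul_pow_four_mul_sq Q hx] at h3
    rw [mul_assoc, sqrt_sq_div_two_mul_pow_four_mul_sq Q hx] at h4
    have h5 : K * x ^ 2 ≤ K * b ^ 2 := by gcongr
    have h6 : 0 ≤ J * √(Q ^ 2 / 2) := by positivity
    have h7 : 0 ≤ K * x ^ 2 := by positivity
    rw [hg, Real.norm_eq_abs, abs_le]
    constructor <;> linarith
  have hcont : ContinuousOn g (Ioi 0) := fun r hr => (hderiv r hr).continuousAt.continuousWithinAt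
  have hm_eq : m = fun r => m₀ + (1 / c ^ 2) * ∫ s in Ioc (0 : ℝ) r, g s := by
    funext r
    simp only [hm, hg]
  refine ⟨fun r hr => ⟨hderiv r hr, hlower r hr, hupper r hr⟩,
    fun r hr => ⟨?_, (hderiv r hr).div_const _, ?_, ?_⟩, ?_⟩
  · rw [hm_eq]
    exact (((hasDerivAt_integral_Ioc_zero_of_bounded hcont hbound hr).const_mul
      (1 / c ^ 2)).const_add m₀).congr_deriv (one_div_mul_eq_div _ _)
  · rw [← neg_div]
    exact div_le_div_of_nonneg_right (hlower r hr) (sq_nonneg c)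
  · exact div_le_div_of_nonneg_right (hupper r hr) (sq_nonneg c)
  · have hlim : ∀ a : ℝ, Tendsto (fun r : ℝ => a * r / c ^ 2) (𝓝[>] 0) (𝓝 0) := fun a =>
      ((Continuous.tendsto' (by fun_prop) 0 0 (by simp)).mono_left nhdsWithin_le_nhds)
    refine tendsto_of_tendsto_of_tendsto_of_le_of_le' (hlim (-(2 * K))) (hlim (4 * L)) ?_ ?_
    · filter_upwards [self_mem_nhdsWithin] with r hr
      rw [neg_mul]
      exact div_le_div_of_nonneg_right (hlower r hr) (sq_nonneg c)
    · filter_upwards [self_mem_nhdsWithin] with r hr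
      exact div_le_div_of_nonneg_right (hupper r hr) (sq_nonneg c)
end

section
/- The Born–Infeld reduced Hamiltonian ζ(μ) := √(1 + 2μ) − 1 on [0,∞) is admissible; precisely: (i) ζ(μ)/μ → 1 as μ → 0⁺; (ii) ζ is differentiable on (0,∞) with ζ'(μ) = 1/√(1+2μ) > 0 and ζ(μ) − μζ'(μ) ≥ 0 for all μ > 0; (iii) ζ'(μ) + 2μζ''(μ) = (1+2μ)^{−3/2} > 0 for all μ > 0; (iv) √(2μ) − 1 ≤ ζ(μ) ≤ √(2μ) for all μ ≥ 0; (v) √(2μ) − 1/2 ≤ 2μζ'(μ) = 2μ/√(1+2μ) ≤ √(2μ) for all μ > 0. Thus ζ satisfies (R1), (R2), (R3) and (R5) with constants J = √2, K = 1, L = 1/4. -/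
open Filter Topology Set

theorem rpow_neg_three_halves_eq_inv_sqrt_pow {x : ℝ} (hx : 0 ≤ x) :
    x ^ (-(3:ℝ)/2) = (√x ^ 3)⁻¹ := by
  rw [neg_div, Real.rpow_neg hx, Real.sqrt_eq_rpow, ← Real.rpow_natCast, ← Real.rpow_mul hx]
  norm_num

theorem hasDerivAt_sqrt_one_add_two_mul {x : ℝ} (hx : 0 < 1 + 2 * x) :
    HasDerivAt (fun y => √(1 + 2 * y)) (1 / √(1 + 2 * x)) x := by
  refine ((((hasDerivAt_id' x).const_mul 2).const_add 1).sqrt hx.ne').congr_deriv ?_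
  field_simp

theorem hasDerivAt_one_div_sqrt_one_add_two_mul {x : ℝ} (hx : 0 < 1 + 2 * x) :
    HasDerivAt (fun y => 1 / √(1 + 2 * y)) (-((1 + 2 * x) ^ (-(3:ℝ)/2))) x := by
  have hs : 0 < √(1 + 2 * x) := Real.sqrt_pos.2 hx
  simp only [one_div]
  refine ((hasDerivAt_sqrt_one_add_two_mul hx).fun_inv hs.ne').congr_deriv ?_
  rw [rpow_neg_three_halves_eq_inv_sqrt_pow hx.le]
  field_simp

theorem tendsto_sqrt_one_add_two_mul_sub_one_div :
    Tendsto (fun x : ℝ => (√(1 + 2 * x) - 1) / x) (𝓝[>] 0) (𝓝 1) := by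
  have h := (hasDerivAt_sqrt_one_add_two_mul (x := 0) (by norm_num)).tendsto_slope_zero_right
  simpa [div_eq_inv_mul] using h

/-- the Born–Infeld reduced Hamiltonian ζ(μ) = √(1+2μ) − 1 is
admissible: it satisfies (R1), (R2) (with ζ'(μ) = 1/√(1+2μ)), (R3)
(with ζ' + 2μζ'' = (1+2μ)^{−3/2} > 0) and (R5) with J = √2, K = 1, L = 1/4. -/
theorem weak_bianchi_stmt18 (ζ : ℝ → ℝ)
    (hζ : ∀ μ, ζ μ = Real.sqrt (1 + 2 * μ) - 1) :
    -- (i) R1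
    Tendsto (fun μ => ζ μ / μ) (𝓝[>] (0:ℝ)) (𝓝 1) ∧
    -- (ii) R2 with ζ'(μ) = 1/√(1+2μ)
    (∀ μ > (0:ℝ),
      HasDerivAt ζ (1 / Real.sqrt (1 + 2 * μ)) μ ∧
      0 < 1 / Real.sqrt (1 + 2 * μ) ∧
      0 ≤ ζ μ - μ * (1 / Real.sqrt (1 + 2 * μ))) ∧
    -- (iii) R3 with ζ''(μ) = −(1+2μ)^{−3/2}, and ζ' + 2μζ'' = (1+2μ)^{−3/2} > 0
    (∀ μ > (0:ℝ),
      HasDerivAt (fun x => 1 / Real.sqrt (1 + 2 * x)) (-((1 + 2 * μ) ^ (-(3:ℝ)/2))) μ ∧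
      1 / Real.sqrt (1 + 2 * μ) + 2 * μ * (-((1 + 2 * μ) ^ (-(3:ℝ)/2)))
        = (1 + 2 * μ) ^ (-(3:ℝ)/2) ∧
      0 < (1 + 2 * μ) ^ (-(3:ℝ)/2)) ∧
    -- (iv) first part of R5 with J = √2, K = 1
    (∀ μ ≥ (0:ℝ), Real.sqrt (2 * μ) - 1 ≤ ζ μ ∧ ζ μ ≤ Real.sqrt (2 * μ)) ∧
    -- (v) second part of R5 with J = √2, L = 1/4
    (∀ μ > (0:ℝ),
      Real.sqrt (2 * μ) - 1/2 ≤ 2 * μ * (1 / Real.sqrt (1 + 2 * μ)) ∧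
      2 * μ * (1 / Real.sqrt (1 + 2 * μ)) = 2 * μ / Real.sqrt (1 + 2 * μ) ∧
      2 * μ / Real.sqrt (1 + 2 * μ) ≤ Real.sqrt (2 * μ)) := by
  have hsqrt {μ : ℝ} (hμ : 0 ≤ μ) : √(1 + 2 * μ) ^ 2 = 1 + 2 * μ := Real.sq_sqrt (by linarith)
  have hsqrt_pos {μ : ℝ} (hμ : 0 ≤ μ) : 0 < √(1 + 2 * μ) := Real.sqrt_pos.2 (by linarith)
  have hsqrt' {μ : ℝ} (hμ : 0 ≤ μ) : √(2 * μ) ^ 2 = 2 * μ := Real.sq_sqrt (by linarith)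
  obtain rfl : ζ = fun μ => √(1 + 2 * μ) - 1 := funext hζ
  refine ⟨tendsto_sqrt_one_add_two_mul_sub_one_div, fun μ hμ => ?_, fun μ hμ => ?_,
    fun μ hμ => ?_, fun μ hμ => ?_⟩
  · have hs := hsqrt hμ.le
    have hp := hsqrt_pos hμ.le
    refine ⟨(hasDerivAt_sqrt_one_add_two_mul (by linarith)).sub_const 1, by positivity, ?_⟩
    have h : √(1 + 2 * μ) - 1 - μ * (1 / √(1 + 2 * μ))
        = (√(1 + 2 * μ) - 1) ^ 2 / (2 * √(1 + 2 * μ)) := by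
      field_simp
      linear_combination hs
    simp only [h]
    positivity
  · have hs := hsqrt hμ.le
    have hp := hsqrt_pos hμ.le
    refine ⟨hasDerivAt_one_div_sqrt_one_add_two_mul (by linarith), ?_, by positivity⟩
    rw [rpow_neg_three_halves_eq_inv_sqrt_pow (by linarith)]
    field_simp
    linear_combination hs
  · have ht := hsqrt' hμ
    have h_le : √(2 * μ) ≤ √(1 + 2 * μ) := Real.sqrt_le_sqrt (by linarith)
    have h_le_add : √(1 + 2 * μ) ≤ √(2 * μ) + 1 :=
      Real.sqrt_le_iff.2 ⟨by positivity, by nlinarith [Real.sqrt_nonneg (2 * μ)]⟩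
    constructor <;> dsimp only <;> linarith
  · have hs := hsqrt hμ.le
    have hp := hsqrt_pos hμ.le
    have ht := hsqrt' hμ.le
    have ht0 := Real.sqrt_nonneg (2 * μ)
    have h_le : √(2 * μ) ≤ √(1 + 2 * μ) := Real.sqrt_le_sqrt (by linarith)
    refine ⟨?_, by ring, ?_⟩
    · rw [mul_one_div, le_div_iff₀ hp]
      set s := √(1 + 2 * μ)
      set t := √(2 * μ)
      have h : (s + t) * (2 * t * (s - t)) ≤ (s + t) * s := by
        nlinarith [sq_nonneg (t - 1), mul_nonneg ht0 hp.le]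
      have := le_of_mul_le_mul_left h (by linarith)
      nlinarith
    · rw [div_le_iff₀ hp]
      nlinarith
end
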